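/- Fix integers N and k with 3 ≤ k ≤ N − 1, fix σ_k² > 0, and fix ε with 0 < ε < 2/σ_k². Then there exists T > 0 such that for all choices of positive σ_i² (i ≠ k) with σ_{k−1}² > T and σ_{k+1}² > T, the modified loopy graph Laplacian Q_ε (obtained from Q by subtracting ε from each of the diagonal entries (k−1, k−1) and (k, k)) is indefinite: there exists x ∈ ℝᴺ with xᵀ Q_ε x < 0, i.e. Q_ε has at least one negative eigenvalue, hence is not positive semi-definite. -/

import Mathlib

open Matrix

/-- The loopy graph Laplacian `Q`, given explicitly as the `N × N` symmetric
tridiagonal matrix with `Q_{1,1} = 1/σ_2²`, `Q_{i,i} = 1/σ_i² + 1/σ_{i+1}²`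
for `1 < i < N`, `Q_{N,N} = 1/σ_N²`, off-diagonal entries
`Q_{i,i+1} = Q_{i+1,i} = -1/σ_{i+1}²` for `i+1 ≠ k`, and
`Q_{k-1,k} = Q_{k,k-1} = +1/σ_k²` (paper index `i` corresponds to the `Fin N`
element with value `i - 1`, and `σ i = σ_i²` is 1-based). -/
noncomputable def Qexp (N k : ℕ) (σ : ℕ → ℝ) : Matrix (Fin N) (Fin N) ℝ := fun i j =>
  if (i : ℕ) = (j : ℕ) then
    (if (i : ℕ) + 1 = 1 then 1 / σ 2
     else if (i : ℕ) + 1 = N then 1 / σ N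
     else 1 / σ ((i : ℕ) + 1) + 1 / σ ((i : ℕ) + 2))
  else if (j : ℕ) = (i : ℕ) + 1 then
    (if (j : ℕ) + 1 = k then 1 / σ k else -(1 / σ ((j : ℕ) + 1)))
  else if (i : ℕ) = (j : ℕ) + 1 then
    (if (i : ℕ) + 1 = k then 1 / σ k else -(1 / σ ((i : ℕ) + 1)))
  else 0

/-- The modified loopy graph Laplacian `Q_ε`, obtained from `Q` by subtracting
`ε` from each of the diagonal entries `(k-1, k-1)` and `(k, k)`, i.e. by
reducing the two self-loop weights from `2/σ_k²` to `2/σ_k² - ε`. -/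
noncomputable def Qeps (N k : ℕ) (σ : ℕ → ℝ) (ε : ℝ) : Matrix (Fin N) (Fin N) ℝ :=
  Qexp N k σ -
    Matrix.diagonal (fun i : Fin N =>
      if (i : ℕ) + 1 = k - 1 ∨ (i : ℕ) + 1 = k then ε else 0)

/-- The quadratic form of a square matrix at a difference of two standard basis vectors. -/
theorem single_sub_single_dotProduct_mulVec {n R : Type*} [Fintype n] [DecidableEq n]
    [CommRing R] (A : Matrix n n R) (a b : n) :
    (Pi.single a 1 - Pi.single b 1) ⬝ᵥ A *ᵥ (Pi.single a 1 - Pi.single b 1) =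
      A a a - A a b - A b a + A b b := by
  simp only [mulVec_sub, sub_dotProduct, dotProduct_sub, single_one_dotProduct,
    mulVec_single_one, col_apply]
  ring

/-- Fix `N`, `k` with `3 ≤ k ≤ N - 1`, fix `σ_k² = s > 0` and `0 < ε < 2/σ_k²`.
Then there exists `T > 0` such that for all choices of positive `σ_i²` with
`σ_{k-1}² > T` and `σ_{k+1}² > T`, the modified loopy graph Laplacian `Q_ε` is
indefinite: there exists `x ∈ ℝᴺ` with `xᵀ Q_ε x < 0`, i.e. `Q_ε` has at least
one negative eigenvalue, hence is not positive semi-definite. -/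
theorem stmt9 (N k : ℕ) (hk : 3 ≤ k) (hkN : k ≤ N - 1)
    (s : ℝ) (hs : 0 < s) (ε : ℝ) (hε : 0 < ε) (hεs : ε < 2 / s) :
    ∃ T > (0 : ℝ), ∀ σ : ℕ → ℝ, (∀ i, 1 ≤ i → i ≤ N → 0 < σ i) → σ k = s →
      T < σ (k - 1) → T < σ (k + 1) →
      (∃ x : Fin N → ℝ, x ⬝ᵥ Qeps N k σ ε *ᵥ x < 0) ∧
      ¬ (Qeps N k σ ε).PosSemidef := by
  refine ⟨1 / ε, by positivity, fun σ _ hσk hT₁ hT₂ => ?_⟩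
  obtain ⟨m, rfl⟩ : ∃ m, k = m + 2 := ⟨k - 2, by omega⟩
  simp only [show m + 2 - 1 = m + 1 by omega] at hT₁
  have hinv : ∀ y, 1 / ε < y → 1 / y < ε := fun y hy => by
    simpa using one_div_lt_one_div_of_lt (by positivity) hy
  have h₁ := hinv _ hT₁
  have h₂ := hinv _ hT₂
  let a : Fin N := ⟨m, by omega⟩
  let b : Fin N := ⟨m + 1, by omega⟩
  have haa : Qeps N (m + 2) σ ε a a = 1 / σ (m + 1) + 1 / s - ε := by
    simp [Qeps, Qexp, a, hσk, show m ≠ 0 by omega, show m + 1 ≠ N by omega]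
  have hbb : Qeps N (m + 2) σ ε b b = 1 / s + 1 / σ (m + 2 + 1) - ε := by
    simp [Qeps, Qexp, b, hσk, show m + 1 + 1 ≠ N by omega]
  have hab : Qeps N (m + 2) σ ε a b = 1 / s := by
    simp [Qeps, Qexp, a, b, hσk]
  have hba : Qeps N (m + 2) σ ε b a = 1 / s := by
    simp [Qeps, Qexp, a, b, hσk, show m ≠ m + 1 + 1 by omega]
  have hneg : (Pi.single a 1 - Pi.single b 1) ⬝ᵥ
      Qeps N (m + 2) σ ε *ᵥ (Pi.single a 1 - Pi.single b 1) < 0 := by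
    rw [single_sub_single_dotProduct_mulVec, haa, hbb, hab, hba]
    linarith
  refine ⟨⟨_, hneg⟩, fun hpsd => hneg.not_ge ?_⟩
  simpa only [star_trivial] using
    hpsd.dotProduct_mulVec_nonneg (Pi.single a 1 - Pi.single b 1)
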